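/- (Convergence without spillback.) Let f be a fundamental diagram on the link [a,b], T > 0, η ∈ (0,1), and S̄ > 0 a constant (the effective supply min{C₁,C₃} of the uncongested downstream link). Let N_ini : [a,b] → ℝ and N_up : [0,T] → ℝ be fixed lower semicontinuous functions, and for each Δ > 0 let 𝒞^Δ be the value condition equal to N_ini on {0}×[a,b], to N_up on [0,T]×{a}, to N_down^Δ(s) = S̄ ∫₀ˢ u_Δ(τ) dτ on [0,T]×{b}, and +∞ elsewhere; let 𝒞⁰ be the same value condition with downstream part replaced by N_down⁰(s) = η S̄ s. Then the Lax-Hopf episolutions converge uniformly: sup_{(t,x)∈[0,T]×[a,b]} |N_{𝒞^Δ}(t,x) − N_{𝒞⁰}(t,x)| → 0 as Δ → 0⁺. -/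

import Mathlib

open Set Filter

/-- The Δ-periodic on-and-off traffic signal with split η: equal to 1 (green)
during the first ηΔ of each cycle of length Δ, and 0 (red) otherwise. -/
noncomputable def uOnOff (Δ η τ : ℝ) : ℝ :=
  if τ - Δ * (⌊τ / Δ⌋ : ℝ) < η * Δ then 1 else 0

/-- The concave conjugate `f*(u) = sup_{ρ ∈ [0,ρ_j]} (f(ρ) − uρ)` of a fundamental
diagram `f` with jam density `ρ_j`. -/
noncomputable def concConj (f : ℝ → ℝ) (ρj u : ℝ) : ℝ :=
  sSup ((fun ρ => f ρ - u * ρ) '' Set.Icc 0 ρj)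

/-- The generalized Lax-Hopf viability episolution on `[0,T] × [a,b]` associated with a
value condition `𝒞 : [0,T]×[a,b] → ℝ ∪ {+∞}` (encoded as an `EReal`-valued function). -/
noncomputable def laxHopf (fs : ℝ → ℝ) (v w T a b : ℝ) (𝒞 : ℝ → ℝ → EReal)
    (t x : ℝ) : EReal :=
  sInf { z : EReal | ∃ u τ : ℝ, u ∈ Set.Icc (-w) v ∧ 0 ≤ τ ∧
    (t - τ) ∈ Set.Icc 0 T ∧ (x - τ * u) ∈ Set.Icc a b ∧
    z = 𝒞 (t - τ) (x - τ * u) + ((τ * fs u : ℝ) : EReal) }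

/-- The value condition equal to `N_ini(y)` at points `(0,y)`, to `N_up(s)` at points `(s,a)`,
to `N_down(s)` at points `(s,b)`, and `+∞` elsewhere. -/
noncomputable def cornerVC (Nini Nup Ndown : ℝ → ℝ) (a b : ℝ) (s y : ℝ) : EReal :=
  if s = 0 then (Nini y : EReal)
  else if y = a then (Nup s : EReal)
  else if y = b then (Ndown s : EReal)
  else (⊤ : EReal)

lemma uOnOff_eq_fract {Δ : ℝ} (hΔ : 0 < Δ) (η τ : ℝ) :
    uOnOff Δ η τ = if Int.fract (τ / Δ) < η then 1 else 0 := by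
  have h : τ - Δ * (⌊τ / Δ⌋ : ℝ) = Int.fract (τ / Δ) * Δ := by
    rw [Int.fract]
    field_simp
  simp only [uOnOff, h, mul_lt_mul_iff_left₀ hΔ]

lemma uOnOff_mem_Icc (Δ η τ : ℝ) : uOnOff Δ η τ ∈ Set.Icc (0 : ℝ) 1 := by
  unfold uOnOff
  split_ifs <;> simp

lemma measurable_uOnOff (Δ η : ℝ) : Measurable (uOnOff Δ η) := by
  unfold uOnOff
  refine Measurable.ite (measurableSet_lt ?_ measurable_const) measurable_const measurable_const
  fun_prop

lemma intervalIntegrable_uOnOff (Δ η c d : ℝ) :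
    IntervalIntegrable (uOnOff Δ η) MeasureTheory.volume c d := by
  refine (intervalIntegrable_const (c := (1 : ℝ))).mono_fun
    (measurable_uOnOff Δ η).aestronglyMeasurable (Eventually.of_forall fun τ => ?_)
  have := uOnOff_mem_Icc Δ η τ
  simpa [abs_of_nonneg this.1] using this.2

lemma uOnOff_periodic {Δ : ℝ} (hΔ : 0 < Δ) (η : ℝ) : Function.Periodic (uOnOff Δ η) Δ := by
  intro τ
  rw [uOnOff_eq_fract hΔ, uOnOff_eq_fract hΔ, add_div, div_self hΔ.ne', Int.fract_add_one]

/-- The total green time of one cycle is `η * Δ`. -/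
lemma integral_uOnOff_cycle {Δ η : ℝ} (hΔ : 0 < Δ) (hη : η ∈ Set.Ioo (0 : ℝ) 1) :
    ∫ τ in (0 : ℝ)..Δ, uOnOff Δ η τ = η * Δ := by
  have hfract : ∀ τ, 0 < τ → τ < Δ → Int.fract (τ / Δ) = τ / Δ := fun τ h0 h1 =>
    Int.fract_eq_self.2 ⟨by positivity, (div_lt_one hΔ).2 h1⟩
  have hle : η * Δ ≤ Δ := by nlinarith [hη.2]
  have hpos : 0 < η * Δ := mul_pos hη.1 hΔ
  have hgreen : ∫ τ in (0 : ℝ)..(η * Δ), uOnOff Δ η τ = ∫ _ in (0 : ℝ)..(η * Δ), (1 : ℝ) := by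
    refine intervalIntegral.integral_congr_Ioo_of_le hpos.le fun τ hτ => ?_
    rw [uOnOff_eq_fract hΔ, hfract τ hτ.1 (hτ.2.trans_le hle), if_pos ((div_lt_iff₀ hΔ).2 hτ.2)]
  have hred : ∫ τ in (η * Δ)..Δ, uOnOff Δ η τ = ∫ _ in (η * Δ)..Δ, (0 : ℝ) := by
    refine intervalIntegral.integral_congr_Ioo_of_le hle fun τ hτ => ?_
    rw [uOnOff_eq_fract hΔ, hfract τ (hpos.trans hτ.1) hτ.2,
      if_neg (not_lt.2 ((le_div_iff₀ hΔ).2 hτ.1.le))]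
  rw [← intervalIntegral.integral_add_adjacent_intervals
    (intervalIntegrable_uOnOff Δ η 0 (η * Δ)) (intervalIntegrable_uOnOff Δ η (η * Δ) Δ),
    hgreen, hred]
  simp

/-- The cumulative green time stays within one cycle of its average. -/
lemma abs_integral_uOnOff_sub_le {Δ η : ℝ} (hΔ : 0 < Δ) (hη : η ∈ Set.Ioo (0 : ℝ) 1) (s : ℝ) :
    |(∫ τ in (0 : ℝ)..s, uOnOff Δ η τ) - η * s| ≤ Δ := by
  set n : ℤ := ⌊s / Δ⌋
  have hn : (n : ℝ) * Δ ≤ s := (le_div_iff₀ hΔ).1 (Int.floor_le _)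
  have hn' : s < (n + 1 : ℝ) * Δ := (div_lt_iff₀ hΔ).1 (Int.lt_floor_add_one _)
  have hwhole : ∫ τ in (0 : ℝ)..(n * Δ), uOnOff Δ η τ = n * (η * Δ) := by
    have := (uOnOff_periodic hΔ η).intervalIntegral_add_zsmul_eq n 0
      (fun t₁ t₂ => intervalIntegrable_uOnOff Δ η t₁ t₂)
    simpa [integral_uOnOff_cycle hΔ hη] using this
  have hsplit := intervalIntegral.integral_add_adjacent_intervals
    (intervalIntegrable_uOnOff Δ η 0 (n * Δ)) (intervalIntegrable_uOnOff Δ η (n * Δ) s)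
  have hnonneg : 0 ≤ ∫ τ in (n * Δ)..s, uOnOff Δ η τ :=
    intervalIntegral.integral_nonneg hn fun τ _ => (uOnOff_mem_Icc Δ η τ).1
  have hupper : ∫ τ in (n * Δ)..s, uOnOff Δ η τ ≤ s - n * Δ := by
    have := intervalIntegral.integral_mono_on hn (intervalIntegrable_uOnOff Δ η (n * Δ) s)
      (intervalIntegrable_const (c := (1 : ℝ))) fun τ _ => (uOnOff_mem_Icc Δ η τ).2
    simpa using this
  rw [← hsplit, hwhole, abs_le]
  constructor <;> nlinarith [hη.1, hη.2]

lemma integral_uOnOff_nonneg {s : ℝ} (hs : 0 ≤ s) (Δ η : ℝ) :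
    0 ≤ ∫ τ in (0 : ℝ)..s, uOnOff Δ η τ :=
  intervalIntegral.integral_nonneg hs fun τ _ => (uOnOff_mem_Icc Δ η τ).1

lemma concConj_nonneg {ρj : ℝ} (hρj : 0 ≤ ρj) {f : ℝ → ℝ} (hfc : ContinuousOn f (Set.Icc 0 ρj))
    (hf0 : f 0 = 0) (u : ℝ) : 0 ≤ concConj f ρj u := by
  have hc : ContinuousOn (fun ρ => f ρ - u * ρ) (Set.Icc 0 ρj) := by fun_prop
  exact le_csSup (isCompact_Icc.bddAbove_image hc) ⟨0, ⟨le_rfl, hρj⟩, by simp [hf0]⟩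

lemma laxHopf_le {fs : ℝ → ℝ} {v w T a b t x u τ : ℝ} (𝒞 : ℝ → ℝ → EReal)
    (hu : u ∈ Set.Icc (-w) v) (hτ : 0 ≤ τ) (hs : t - τ ∈ Set.Icc 0 T)
    (hy : x - τ * u ∈ Set.Icc a b) :
    laxHopf fs v w T a b 𝒞 t x ≤ 𝒞 (t - τ) (x - τ * u) + ((τ * fs u : ℝ) : EReal) :=
  sInf_le ⟨u, τ, hu, hτ, hs, hy, rfl⟩

lemma laxHopf_le_add {fs : ℝ → ℝ} {v w T a b ε : ℝ} {𝒞₁ 𝒞₂ : ℝ → ℝ → EReal}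
    (h : ∀ s ∈ Set.Icc 0 T, ∀ y ∈ Set.Icc a b, 𝒞₁ s y ≤ 𝒞₂ s y + (ε : EReal)) (t x : ℝ) :
    laxHopf fs v w T a b 𝒞₁ t x ≤ laxHopf fs v w T a b 𝒞₂ t x + (ε : EReal) := by
  rw [← EReal.sub_le_iff_le_add (.inl (EReal.coe_ne_bot _)) (.inl (EReal.coe_ne_top _))]
  refine le_sInf ?_
  rintro z ⟨u, τ, hu, hτ, hs, hy, rfl⟩
  rw [EReal.sub_le_iff_le_add (.inl (EReal.coe_ne_bot _)) (.inl (EReal.coe_ne_top _))]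
  refine (laxHopf_le 𝒞₁ hu hτ hs hy).trans ?_
  rw [add_right_comm]
  gcongr
  exact h _ hs _ hy

lemma le_laxHopf {fs : ℝ → ℝ} (hfs : ∀ u, 0 ≤ fs u) {v w T a b m : ℝ} {𝒞 : ℝ → ℝ → EReal}
    (h : ∀ s ∈ Set.Icc 0 T, ∀ y ∈ Set.Icc a b, (m : EReal) ≤ 𝒞 s y) (t x : ℝ) :
    (m : EReal) ≤ laxHopf fs v w T a b 𝒞 t x := by
  refine le_sInf ?_
  rintro z ⟨u, τ, hu, hτ, hs, hy, rfl⟩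
  refine (h _ hs _ hy).trans (le_add_of_nonneg_right ?_)
  exact_mod_cast mul_nonneg hτ (hfs u)

lemma laxHopf_lt_top {fs : ℝ → ℝ} {v w T a b t x : ℝ} {𝒞 : ℝ → ℝ → EReal} (hv : 0 ≤ v)
    (hw : 0 ≤ w) (h : 𝒞 0 x < ⊤) (ht : t ∈ Set.Icc 0 T) (hx : x ∈ Set.Icc a b) :
    laxHopf fs v w T a b 𝒞 t x < ⊤ := by
  refine (laxHopf_le (u := 0) (τ := t) 𝒞 ⟨by linarith, hv⟩ ht.1
    ⟨by simp, by simpa using ht.1.trans ht.2⟩ (by simpa using hx)).trans_lt ?_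
  rw [sub_self, mul_zero, sub_zero]
  exact EReal.add_lt_top h.ne (EReal.coe_ne_top _)

lemma cornerVC_le_add {Nini Nup N₁ N₂ : ℝ → ℝ} {a b s y ε : ℝ} (hε : 0 ≤ ε)
    (h : N₁ s ≤ N₂ s + ε) :
    cornerVC Nini Nup N₁ a b s y ≤ cornerVC Nini Nup N₂ a b s y + (ε : EReal) := by
  unfold cornerVC
  split_ifs
  · exact_mod_cast le_add_of_nonneg_right hε
  · exact_mod_cast le_add_of_nonneg_right hε
  · exact_mod_cast h
  · simp

lemma le_cornerVC {Nini Nup Ndown : ℝ → ℝ} {a b s y m : ℝ} (h₁ : m ≤ Nini y) (h₂ : m ≤ Nup s)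
    (h₃ : m ≤ Ndown s) : (m : EReal) ≤ cornerVC Nini Nup Ndown a b s y := by
  unfold cornerVC
  split_ifs
  · exact_mod_cast h₁
  · exact_mod_cast h₂
  · exact_mod_cast h₃
  · exact le_top

lemma EReal.abs_toReal_sub_toReal_le {x y : EReal} {ε : ℝ} (hx : x ≠ ⊤) (hx' : x ≠ ⊥)
    (hy : y ≠ ⊤) (hy' : y ≠ ⊥) (h₁ : x ≤ y + (ε : EReal)) (h₂ : y ≤ x + (ε : EReal)) :
    |x.toReal - y.toReal| ≤ ε := by
  lift x to ℝ using ⟨hx, hx'⟩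
  lift y to ℝ using ⟨hy, hy'⟩
  norm_cast at h₁ h₂
  simp only [EReal.toReal_coe, abs_le]
  constructor <;> linarith

/-- **Convergence without spillback.** With a constant effective supply `Sbar` (no spillback),
the solution of the on-and-off signal model converges uniformly to that of the continuum
signal model as the signal cycle `Δ` tends to `0⁺`. -/
theorem laxHopf_onOff_tendsto_continuum_no_spillback
    -- the fundamental diagram
    (ρj : ℝ) (hρj : 0 < ρj) (f : ℝ → ℝ)
    (hfc : ContinuousOn f (Set.Icc 0 ρj)) (hconc : ConcaveOn ℝ (Set.Icc 0 ρj) f)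
    (hf0 : f 0 = 0) (hfρj : f ρj = 0)
    -- wave speeds: right derivative of f at 0 and minus the left derivative at ρ_j
    (v w : ℝ) (hv : 0 < v) (hw : 0 < w)
    (hv' : HasDerivWithinAt f v (Set.Ici 0) 0)
    (hw' : HasDerivWithinAt f (-w) (Set.Iic ρj) ρj)
    -- the domain, split, and constant effective supply
    (T a b : ℝ) (hT : 0 < T) (hab : a < b)
    (η : ℝ) (hη : η ∈ Set.Ioo (0:ℝ) 1) (Sbar : ℝ) (hSbar : 0 < Sbar)
    -- the (lower semicontinuous) initial and upstream data
    (Nini Nup : ℝ → ℝ)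
    (hini : LowerSemicontinuousOn Nini (Set.Icc a b))
    (hup : LowerSemicontinuousOn Nup (Set.Icc 0 T)) :
    Tendsto (fun Δ : ℝ => ⨆ p : (Set.Icc 0 T ×ˢ Set.Icc a b : Set (ℝ × ℝ)),
        |(laxHopf (concConj f ρj) v w T a b
            (cornerVC Nini Nup (fun s => Sbar * ∫ τ in (0:ℝ)..s, uOnOff Δ η τ) a b)
            (p : ℝ × ℝ).1 (p : ℝ × ℝ).2).toReal -
          (laxHopf (concConj f ρj) v w T a b
            (cornerVC Nini Nup (fun s => η * Sbar * s) a b)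
            (p : ℝ × ℝ).1 (p : ℝ × ℝ).2).toReal|)
      (nhdsWithin 0 (Set.Ioi 0)) (nhds 0) := by
  obtain ⟨m₁, hm₁⟩ := hini.bddBelow_of_isCompact isCompact_Icc
  obtain ⟨m₂, hm₂⟩ := hup.bddBelow_of_isCompact isCompact_Icc
  have hNini : ∀ y ∈ Set.Icc a b, m₁ ≤ Nini y := fun y hy => hm₁ (Set.mem_image_of_mem _ hy)
  have hNup : ∀ s ∈ Set.Icc 0 T, m₂ ≤ Nup s := fun s hs => hm₂ (Set.mem_image_of_mem _ hs)
  have hbot : ∀ N : ℝ → ℝ, (∀ s ∈ Set.Icc 0 T, 0 ≤ N s) → ∀ t x,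
      laxHopf (concConj f ρj) v w T a b (cornerVC Nini Nup N a b) t x ≠ ⊥ := by
    intro N hN t x
    refine ((EReal.bot_lt_coe (min (min m₁ m₂) 0)).trans_le
      (le_laxHopf (concConj_nonneg hρj.le hfc hf0) (fun s hs y hy => ?_) t x)).ne'
    exact le_cornerVC (((min_le_left _ _).trans (min_le_left _ _)).trans (hNini y hy))
      (((min_le_left _ _).trans (min_le_right _ _)).trans (hNup s hs))
      ((min_le_right _ _).trans (hN s hs))
  have htop : ∀ N : ℝ → ℝ, ∀ t ∈ Set.Icc 0 T, ∀ x ∈ Set.Icc a b,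
      laxHopf (concConj f ρj) v w T a b (cornerVC Nini Nup N a b) t x ≠ ⊤ :=
    fun N t ht x hx => (laxHopf_lt_top hv.le hw.le (by simp [cornerVC]) ht hx).ne
  have hlim : Tendsto (fun Δ : ℝ => Sbar * Δ) (nhdsWithin 0 (Set.Ioi 0)) (nhds 0) := by
    have : Tendsto (fun Δ : ℝ => Sbar * Δ) (nhds 0) (nhds (Sbar * 0)) :=
      tendsto_id.const_mul Sbar
    rw [mul_zero] at this
    exact this.mono_left nhdsWithin_le_nhds
  refine squeeze_zero' (Eventually.of_forall fun Δ => Real.iSup_nonneg fun _ => abs_nonneg _)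
    ?_ hlim
  filter_upwards [self_mem_nhdsWithin] with Δ hΔ
  have hΔ : 0 < Δ := hΔ
  have hε : 0 ≤ Sbar * Δ := by positivity
  refine Real.iSup_le ?_ hε
  rintro ⟨⟨t, x⟩, ht, hx⟩
  have hdist : ∀ s, |Sbar * (∫ τ in (0:ℝ)..s, uOnOff Δ η τ) - η * Sbar * s| ≤ Sbar * Δ := by
    intro s
    rw [show ∀ I : ℝ, Sbar * I - η * Sbar * s = Sbar * (I - η * s) from fun I => by ring,
      abs_mul, abs_of_pos hSbar]
    exact mul_le_mul_of_nonneg_left (abs_integral_uOnOff_sub_le hΔ hη s) hSbar.le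
  refine EReal.abs_toReal_sub_toReal_le (htop _ t ht x hx)
    (hbot _ (fun s hs => mul_nonneg hSbar.le (integral_uOnOff_nonneg hs.1 Δ η)) t x)
    (htop _ t ht x hx)
    (hbot _ (fun s hs => mul_nonneg (mul_pos hη.1 hSbar).le hs.1) t x)
    (laxHopf_le_add (fun s _ y _ => cornerVC_le_add hε ?_) t x)
    (laxHopf_le_add (fun s _ y _ => cornerVC_le_add hε ?_) t x)
  · linarith [(abs_le.1 (hdist s)).2]
  · linarith [(abs_le.1 (hdist s)).1]
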